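/- G_{f₀} is topologically transitive on (𝒳, d): for every pair of nonempty open sets U, V ⊆ 𝒳, there exists an integer k > 0 such that G_{f₀}^k(U) ∩ V ≠ ∅. -/

import Mathlib

open scoped BigOperators

/-- The strategy distance `d_s`. -/
noncomputable def ds (N : ℕ) (S T : ℕ → Fin N) : ℝ :=
  (9 / N) * ∑' k : ℕ, |((S k : ℕ) : ℝ) - ((T k : ℕ) : ℝ)| / 10 ^ (k + 1)

/-- The state distance `d_e`: number of differing cells. -/
def de (N : ℕ) (E F : Fin N → Bool) : ℕ :=
  (Finset.univ.filter fun j => E j ≠ F j).card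

/-- The distance `d` on the phase space `𝒳 = (ℕ → Fin N) × (Fin N → Bool)`. -/
noncomputable def dX (N : ℕ) (X Y : (ℕ → Fin N) × (Fin N → Bool)) : ℝ :=
  (de N X.2 Y.2 : ℝ) + ds N X.1 Y.1
/-- The map `F_f`. -/
def Ff (N : ℕ) (f : (Fin N → Bool) → (Fin N → Bool))
    (k : Fin N) (E : Fin N → Bool) : Fin N → Bool :=
  fun j => if j = k then f E j else E j

/-- The map `G_f` on the phase space. -/
def Gf (N : ℕ) (f : (Fin N → Bool) → (Fin N → Bool)) :
    ((ℕ → Fin N) × (Fin N → Bool)) → ((ℕ → Fin N) × (Fin N → Bool)) :=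
  fun X => (fun n => X.1 (n + 1), Ff N f (X.1 0) X.2)

/-- The vectorial negation `f₀`. -/
def f0 (N : ℕ) : (Fin N → Bool) → (Fin N → Bool) := fun E j => !(E j)

/-- Prepend a finite list to a strategy. -/
def appStrat {N : ℕ} : List (Fin N) → (ℕ → Fin N) → (ℕ → Fin N)
  | [], T => T
  | a :: L, T => fun n => Nat.casesOn n a (fun m => appStrat L T m)

theorem appStrat_append {N : ℕ} (L M : List (Fin N)) (T : ℕ → Fin N) :
    appStrat (L ++ M) T = appStrat L (appStrat M T) := by
  induction L with
  | nil => rfl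
  | cons a L ih => simp only [List.cons_append, appStrat, ih]

theorem exists_prefix {N : ℕ} (n : ℕ) : ∀ S : ℕ → Fin N,
    ∃ L : List (Fin N), L.length = n ∧ ∀ T k, k < n → appStrat L T k = S k := by
  induction n with
  | zero => intro S; exact ⟨[], rfl, fun _ _ h => absurd h (Nat.not_lt_zero _)⟩
  | succ n ih =>
    intro S
    obtain ⟨L, hL, h⟩ := ih (fun m => S (m + 1))
    refine ⟨S 0 :: L, by simp [hL], fun T k hk => ?_⟩
    cases k with
    | zero => rfl
    | succ k => exact h T k (by omega)

theorem iterate_appStrat {N : ℕ} (f : (Fin N → Bool) → (Fin N → Bool)) (L : List (Fin N)) :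
    ∀ (T : ℕ → Fin N) (E : Fin N → Bool),
    (Gf N f)^[L.length] (appStrat L T, E) = (T, L.foldl (fun E k => Ff N f k E) E) := by
  induction L with
  | nil => intro T E; rfl
  | cons a L ih =>
    intro T E
    rw [List.length_cons, Function.iterate_succ_apply, List.foldl_cons, ← ih]
    rfl

theorem exists_path {N : ℕ} (s : Finset (Fin N)) : ∀ E E' : Fin N → Bool,
    (∀ j, j ∉ s → E j = E' j) →
    ∃ L : List (Fin N), L.foldl (fun E k => Ff N (f0 N) k E) E = E' := by
  induction s using Finset.induction_on with
  | empty => intro E E' h; exact ⟨[], funext fun j => h j (by simp)⟩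
  | insert a s _ ih =>
    intro E E' h
    by_cases hE : E a = E' a
    · refine ih E E' fun j hj => ?_
      by_cases hja : j = a
      · rw [hja, hE]
      · exact h j (by simp [hja, hj])
    · obtain ⟨L, hL⟩ := ih (Ff N (f0 N) a E) E' (fun j hj => by
        by_cases hja : j = a
        · subst hja
          simp only [Ff, f0, if_true]
          revert hE
          cases E j <;> cases E' j <;> simp
        · simp only [Ff, if_neg hja]
          exact h j (by simp [hja, hj]))
      exact ⟨a :: L, hL⟩

theorem ds_le {N : ℕ} (hN : 1 ≤ N) (n : ℕ) (S T : ℕ → Fin N) (h : ∀ k, k < n → T k = S k) :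
    ds N S T ≤ 18 * (1 / 5 : ℝ) ^ n := by
  have hN' : (0 : ℝ) < N := by exact_mod_cast hN
  have hb : ∀ k : ℕ, |((S k : ℕ) : ℝ) - ((T k : ℕ) : ℝ)| / 10 ^ (k + 1)
      ≤ (N * (1 / 5 : ℝ) ^ n) * (1 / 2) ^ k := by
    intro k
    by_cases hk : k < n
    · rw [h k hk, sub_self, abs_zero, zero_div]; positivity
    · have h1 : |((S k : ℕ) : ℝ) - ((T k : ℕ) : ℝ)| ≤ N := by
        have a : ((S k : ℕ) : ℝ) ≤ N := by exact_mod_cast (S k).2.le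
        have b : ((T k : ℕ) : ℝ) ≤ N := by exact_mod_cast (T k).2.le
        have c : (0 : ℝ) ≤ ((S k : ℕ) : ℝ) := by positivity
        have d : (0 : ℝ) ≤ ((T k : ℕ) : ℝ) := by positivity
        rw [abs_le]; constructor <;> linarith
      have h2 : (1 / 5 : ℝ) ^ k ≤ (1 / 5 : ℝ) ^ n :=
        pow_le_pow_of_le_one (by norm_num) (by norm_num) (by omega)
      have h3 : (1 : ℝ) / 10 ^ (k + 1) ≤ (1 / 5 : ℝ) ^ k * (1 / 2) ^ k := by
        rw [← mul_pow, show (1 / 5 * (1 / 2) : ℝ) = 1 / 10 by norm_num, one_div_pow]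
        apply one_div_le_one_div_of_le (by positivity)
        exact pow_le_pow_right₀ (by norm_num) (by omega)
      calc _ = |((S k : ℕ) : ℝ) - ((T k : ℕ) : ℝ)| * (1 / 10 ^ (k + 1)) := by ring
        _ ≤ N * ((1 / 5 : ℝ) ^ n * (1 / 2) ^ k) := by
          apply mul_le_mul h1 _ (by positivity) hN'.le
          exact h3.trans (mul_le_mul_of_nonneg_right h2 (by positivity))
        _ = _ := by ring
  have hs : Summable fun k : ℕ => (N * (1 / 5 : ℝ) ^ n) * (1 / 2 : ℝ) ^ k :=
    summable_geometric_two.mul_left _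
  have hs' := Summable.of_nonneg_of_le (fun k => by positivity) hb hs
  have ht := hs'.tsum_le_tsum hb hs
  rw [tsum_mul_left, tsum_geometric_two] at ht
  unfold ds
  calc _ ≤ (9 / N : ℝ) * ((N * (1 / 5 : ℝ) ^ n) * 2) :=
        mul_le_mul_of_nonneg_left ht (by positivity)
    _ = _ := by field_simp; ring

/-- `G_{f₀}` is topologically transitive on `(𝒳, d)`. -/
theorem Gf0_topologically_transitive (N : ℕ) (hN : 1 ≤ N)
    (U V : Set ((ℕ → Fin N) × (Fin N → Bool)))
    (hU : ∀ x ∈ U, ∃ ε : ℝ, 0 < ε ∧ ∀ y, dX N x y < ε → y ∈ U)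
    (hV : ∀ x ∈ V, ∃ ε : ℝ, 0 < ε ∧ ∀ y, dX N x y < ε → y ∈ V)
    (hUne : U.Nonempty) (hVne : V.Nonempty) :
    ∃ k : ℕ, 0 < k ∧ ((Gf N (f0 N))^[k] '' U ∩ V).Nonempty := by
  obtain ⟨⟨S, E⟩, hx⟩ := hUne
  obtain ⟨⟨T, E'⟩, hy⟩ := hVne
  obtain ⟨ε, hε, hball⟩ := hU _ hx
  obtain ⟨n, hn⟩ := exists_pow_lt_of_lt_one (show (0 : ℝ) < ε / 18 by positivity)
    (show (1 / 5 : ℝ) < 1 by norm_num)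
  obtain ⟨L, hL, hpre⟩ := exists_prefix (n + 1) S
  obtain ⟨M, hM⟩ := exists_path Finset.univ (L.foldl (fun E k => Ff N (f0 N) k E) E) E'
    (fun j hj => absurd (Finset.mem_univ j) hj)
  refine ⟨(L ++ M).length, by rw [List.length_append]; omega, (T, E'),
    ⟨(appStrat (L ++ M) T, E), hball _ ?_, ?_⟩, hy⟩
  · have := ds_le hN n S (appStrat (L ++ M) T) (fun k hk => by
      rw [appStrat_append]; exact hpre _ k (by omega))
    simp only [dX, de]
    simp
    linarith
  · rw [iterate_appStrat, List.foldl_append, hM]
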